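/- arXiv:2305.18625 — 2 statements merged into one kernel-verified Lean document; each statement's English description precedes it below -/
import Mathlib

section
/- Let q ≥ 2, let H ≤ (ℤ/qℤ)^× with |H| ≥ q^{7/8}, and let cH be a coset. For a ∈ (ℤ/qℤ)^× let t_a ∈ [−q/2, q/2) ∩ ℤ be the representative of a + ā mod q, where ā is the inverse of a. Then for every ε > 0 and every T with 2 ≤ T ≤ q^{1/10}, the number of a ∈ cH with |t_a| ≤ q/T satisfies #{a ∈ cH : |t_a| ≤ q/T} ≪_ε T^{−1}|H| + T·q^{1/2+ε}|H|^{1/4}. -/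
open Pointwise

open Finset in
/-- The divisor bound `τ(n) ≪_δ n ^ δ`. -/
theorem exists_card_divisors_le_rpow (δ : ℝ) (hδ : 0 < δ) :
    ∃ A : ℝ, 1 ≤ A ∧ ∀ n : ℕ, n ≠ 0 → (#n.divisors : ℝ) ≤ A * (n : ℝ) ^ δ := by
  set c : ℝ := δ * Real.log 2 with hc
  have hc0 : 0 < c := mul_pos hδ (Real.log_pos one_lt_two)
  set B : ℝ := 1 + 1 / c with hB
  have hB1 : 1 ≤ B := by rw [hB]; linarith [one_div_pos.mpr hc0]
  set P : ℕ := ⌈(2 : ℝ) ^ (1 / δ)⌉₊ with hP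
  refine ⟨B ^ P, one_le_pow₀ hB1, fun n hn ↦ ?_⟩
  have key : ∀ p ∈ n.primeFactors, ((n.factorization p + 1 : ℕ) : ℝ) ≤
      (if p < P then B else 1) * ((p : ℝ) ^ (n.factorization p)) ^ δ := by
    intro p hp
    have hp2 : 2 ≤ p := (Nat.prime_of_mem_primeFactors hp).two_le
    have hp2' : (2 : ℝ) ≤ p := by exact_mod_cast hp2
    set v := n.factorization p
    have hpow : ((p : ℝ) ^ v) ^ δ = ((p : ℝ) ^ δ) ^ v := by
      rw [← Real.rpow_natCast, ← Real.rpow_natCast, ← Real.rpow_mul (by positivity),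
        ← Real.rpow_mul (by positivity), mul_comm]
    rw [hpow]
    split_ifs with h
    · have h1 : 1 + c ≤ (p : ℝ) ^ δ := by
        calc 1 + c ≤ Real.exp c := by linarith [Real.add_one_le_exp c]
          _ = (2 : ℝ) ^ δ := by rw [Real.rpow_def_of_pos two_pos, hc, mul_comm]
          _ ≤ _ := by gcongr
      have h2 : 1 + v * c ≤ ((p : ℝ) ^ δ) ^ v := by
        calc 1 + v * c ≤ (1 + c) ^ v := one_add_mul_le_pow (by linarith) v
          _ ≤ _ := by gcongr
      calc ((v + 1 : ℕ) : ℝ) ≤ B * (1 + v * c) := by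
            have : B * (1 + v * c) = 1 + v * c + 1 / c + v := by rw [hB]; field_simp; ring
            rw [this]; push_cast
            have := one_div_pos.mpr hc0
            have : 0 ≤ v * c := by positivity
            linarith
        _ ≤ _ := by gcongr
    · have h1 : (2 : ℝ) ≤ (p : ℝ) ^ δ := by
        have h3 : (2 : ℝ) ^ (1 / δ) ≤ p := (Nat.le_ceil _).trans (by exact_mod_cast not_lt.mp h)
        calc (2 : ℝ) = ((2 : ℝ) ^ (1 / δ)) ^ δ := by
              rw [← Real.rpow_mul two_pos.le, one_div_mul_cancel hδ.ne', Real.rpow_one]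
          _ ≤ _ := by gcongr
      rw [one_mul]
      calc ((v + 1 : ℕ) : ℝ) ≤ ((2 ^ v : ℕ) : ℝ) := by exact_mod_cast Nat.lt_two_pow_self
        _ = (2 : ℝ) ^ v := by push_cast; rfl
        _ ≤ _ := by gcongr
  calc (#n.divisors : ℝ) = ∏ p ∈ n.primeFactors, ((n.factorization p + 1 : ℕ) : ℝ) := by
        rw [Nat.card_divisors hn]; push_cast; rfl
    _ ≤ ∏ p ∈ n.primeFactors,
          ((if p < P then B else 1) * ((p : ℝ) ^ (n.factorization p)) ^ δ) :=
        prod_le_prod (fun _ _ ↦ by positivity) key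
    _ = B ^ #(n.primeFactors.filter (· < P)) * (n : ℝ) ^ δ := by
        rw [prod_mul_distrib, Real.finsetProd_rpow _ _ (fun _ _ ↦ by positivity),
          prod_ite, prod_const, prod_const_one, mul_one]
        congr 2
        conv_rhs => rw [← Nat.prod_factorization_pow_eq_self hn]
        rw [Finsupp.prod]; push_cast; rfl
    _ ≤ B ^ P * (n : ℝ) ^ δ := by
        gcongr
        calc #(n.primeFactors.filter (· < P)) ≤ #(range P) :=
              card_le_card fun x hx ↦ mem_range.mpr (mem_filter.mp hx).2
          _ = P := card_range P

open Finset in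
theorem card_le_div_of_pairwise_modEq {q L : ℕ} (hL : L ∣ q) {S : Finset ℕ}
    (hS : S ⊆ range q) (h : ∀ x ∈ S, ∀ y ∈ S, x ≡ y [MOD L]) : #S ≤ q / L := by
  rw [← card_range (q / L)]
  refine card_le_card_of_injOn (· / L) (fun x hx ↦ ?_) (fun x hx y hy hxy ↦ ?_)
  · have := mem_range.mp (hS hx)
    simpa using Nat.div_lt_div_of_lt_of_dvd hL this
  · have h1 : x % L = y % L := h x hx y hy
    have h2 : x / L = y / L := hxy
    rw [← Nat.div_add_mod x L, ← Nat.div_add_mod y L, h1, h2]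

open Finset in
theorem card_filter_dvd_mul_mul_le {q : ℕ} (hq : 0 < q) :
    #{p ∈ range q ×ˢ range q |
      (q : ℤ) ∣ (1 + p.1) * (p.2 - 1) * (p.1 - p.2)} ≤ 2 * q * #q.divisors ^ 3 := by
  set f : ℕ × ℕ → ℕ × ℕ × ℕ := fun p ↦
    (Int.gcd (1 + p.1) q, Int.gcd (p.2 - 1) q, Int.gcd (p.1 - p.2) q) with hf
  have hcard : #q.divisors ^ 3 = #(q.divisors ×ˢ q.divisors ×ˢ q.divisors) := by
    simp only [card_product]; ring
  rw [hcard]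
  have hmem : ∀ z : ℤ, Int.gcd z q ∈ q.divisors := fun z ↦ by
    rw [Nat.mem_divisors]
    exact ⟨by simpa using Int.gcd_dvd_natAbs_right z q, hq.ne'⟩
  refine card_le_mul_card_image_of_maps_to (f := f)
    (fun p _ ↦ by simp only [hf, mem_product, hmem, and_self]) _ ?_
  rintro ⟨d₁, d₂, d₃⟩ hd
  simp only [mem_product, Nat.mem_divisors] at hd
  obtain ⟨⟨hd₁, -⟩, ⟨hd₂, -⟩, ⟨hd₃, -⟩⟩ := hd
  set S := {p ∈ {p ∈ range q ×ˢ range q | (q : ℤ) ∣ (1 + p.1) * (p.2 - 1) * (p.1 - p.2)} |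
    f p = (d₁, d₂, d₃)} with hS
  rcases S.eq_empty_or_nonempty with h0 | ⟨p₀, hp₀⟩
  · rw [h0]; simp
  have hprop : ∀ p ∈ S, p.1 < q ∧ p.2 < q ∧ (q : ℤ) ∣ (1 + p.1) * (p.2 - 1) * (p.1 - p.2) ∧
      (d₁ : ℤ) ∣ 1 + p.1 ∧ (d₂ : ℤ) ∣ p.2 - 1 ∧ (d₃ : ℤ) ∣ p.1 - p.2 := by
    intro p hp
    simp only [hS, mem_filter, mem_product, mem_range, hf, Prod.mk.injEq] at hp
    obtain ⟨⟨⟨h1, h2⟩, h3⟩, rfl, rfl, rfl⟩ := hp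
    exact ⟨h1, h2, h3, Int.gcd_dvd_left .., Int.gcd_dvd_left .., Int.gcd_dvd_left ..⟩
  have hqd : q ∣ d₁ * d₂ * d₃ := by
    have h3 := (hprop p₀ hp₀).2.2.1
    simp only [hS, mem_filter, hf, Prod.mk.injEq] at hp₀
    obtain ⟨-, rfl, rfl, rfl⟩ := hp₀
    have h5 : q = Int.gcd ((1 + p₀.1) * (p₀.2 - 1) * (p₀.1 - p₀.2)) q := by
      rw [Int.gcd_comm]
      exact (Nat.gcd_eq_left (by simpa using Int.natAbs_dvd_natAbs.mpr h3)).symm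
    conv_lhs => rw [h5]
    exact (Int.gcd_mul_left_dvd_mul_gcd _ _ _).trans
      (mul_dvd_mul_right (Int.gcd_mul_left_dvd_mul_gcd _ _ _) _)
  set e := Nat.gcd d₂ d₃ with he
  have hg : Nat.gcd d₁ e ∣ 2 := by
    obtain ⟨-, -, -, h1, h2, h3⟩ := hprop p₀ hp₀
    have g1 : ((Nat.gcd d₁ e : ℕ) : ℤ) ∣ d₁ := by exact_mod_cast Nat.gcd_dvd_left _ _
    have g2 : ((Nat.gcd d₁ e : ℕ) : ℤ) ∣ d₂ := by
      exact_mod_cast (Nat.gcd_dvd_right d₁ e).trans (Nat.gcd_dvd_left _ _)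
    have g3 : ((Nat.gcd d₁ e : ℕ) : ℤ) ∣ d₃ := by
      exact_mod_cast (Nat.gcd_dvd_right d₁ e).trans (Nat.gcd_dvd_right _ _)
    have := dvd_sub (dvd_sub (g1.trans h1) (g2.trans h2)) (g3.trans h3)
    have h4 : ((1 : ℤ) + p₀.1) - (p₀.2 - 1) - (p₀.1 - p₀.2) = 2 := by ring
    rw [h4] at this
    exact_mod_cast this
  have hed : e ∣ q := (Nat.gcd_dvd_left _ _).trans hd₂
  have hl₁ : Nat.lcm d₁ e ∣ q := Nat.lcm_dvd hd₁ hed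
  have hl₂ : Nat.lcm d₂ d₃ ∣ q := Nat.lcm_dvd hd₂ hd₃
  have hmod : ∀ (d x y : ℕ), x ≡ y [MOD d] ↔ (d : ℤ) ∣ x - y := fun d x y ↦ by
    rw [Nat.ModEq.comm]; exact Nat.modEq_iff_dvd
  have hlcm : ∀ (a b x y : ℕ), (a : ℤ) ∣ x - y → (b : ℤ) ∣ x - y →
      x ≡ y [MOD Nat.lcm a b] := fun a b x y h1 h2 ↦ by
    rw [hmod]
    have := Int.coe_lcm_dvd h1 h2
    simpa [Int.lcm] using this
  have hX : #(S.image Prod.fst) ≤ q / Nat.lcm d₁ e := by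
    refine card_le_div_of_pairwise_modEq hl₁ (fun x hx ↦ ?_) ?_
    · obtain ⟨p, hp, rfl⟩ := mem_image.mp hx
      exact mem_range.mpr (hprop p hp).1
    · intro x hx y hy
      obtain ⟨p, hp, rfl⟩ := mem_image.mp hx
      obtain ⟨p', hp', rfl⟩ := mem_image.mp hy
      obtain ⟨-, -, -, h1, h2, h3⟩ := hprop p hp
      obtain ⟨-, -, -, h1', h2', h3'⟩ := hprop p' hp'
      refine hlcm _ _ _ _ ?_ ?_
      · have := dvd_sub h1 h1'
        rwa [show ((1 : ℤ) + p.1) - (1 + p'.1) = p.1 - p'.1 by ring] at this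
      · have g2 : (e : ℤ) ∣ d₂ := by exact_mod_cast Nat.gcd_dvd_left _ _
        have g3 : (e : ℤ) ∣ d₃ := by exact_mod_cast Nat.gcd_dvd_right _ _
        have := dvd_add (dvd_sub (g2.trans h2) (g2.trans h2'))
          (dvd_sub (g3.trans h3) (g3.trans h3'))
        rwa [show ((p.2 : ℤ) - 1) - (p'.2 - 1) + ((p.1 - p.2) - (p'.1 - p'.2)) = p.1 - p'.1 by
          ring] at this
  have hY : ∀ x ∈ S.image Prod.fst, #{p ∈ S | p.1 = x} ≤ q / Nat.lcm d₂ d₃ := by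
    intro x _
    have hinj : #{p ∈ S | p.1 = x} = #({p ∈ S | p.1 = x}.image Prod.snd) := by
      refine (card_image_of_injOn ?_).symm
      intro p hp p' hp' h
      have h1 := (mem_filter.mp hp).2
      have h2 := (mem_filter.mp hp').2
      exact Prod.ext (h1.trans h2.symm) h
    rw [hinj]
    refine card_le_div_of_pairwise_modEq hl₂ (fun y hy ↦ ?_) ?_
    · obtain ⟨p, hp, rfl⟩ := mem_image.mp hy
      exact mem_range.mpr (hprop p (mem_filter.mp hp).1).2.1
    · intro y hy y' hy'
      obtain ⟨p, hp, rfl⟩ := mem_image.mp hy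
      obtain ⟨p', hp', rfl⟩ := mem_image.mp hy'
      obtain ⟨hp, hx⟩ := mem_filter.mp hp
      obtain ⟨hp', hx'⟩ := mem_filter.mp hp'
      obtain ⟨-, -, -, h1, h2, h3⟩ := hprop p hp
      obtain ⟨-, -, -, h1', h2', h3'⟩ := hprop p' hp'
      refine hlcm _ _ _ _ ?_ ?_
      · have := dvd_sub h2 h2'
        rwa [show ((p.2 : ℤ) - 1) - (p'.2 - 1) = p.2 - p'.2 by ring] at this
      · have := dvd_sub h3' h3
        rwa [hx, hx', show ((x : ℤ) - p'.2) - (x - p.2) = p.2 - p'.2 by ring] at this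
  have hle := (card_le_mul_card_image S _ hY).trans (Nat.mul_le_mul_left _ hX)
  refine hle.trans ?_
  set l₁ := Nat.lcm d₁ e
  set l₂ := Nat.lcm d₂ d₃
  have hl₁0 : 0 < l₁ := Nat.pos_of_dvd_of_pos hl₁ hq
  have hl₂0 : 0 < l₂ := Nat.pos_of_dvd_of_pos hl₂ hq
  have e1 : Nat.gcd d₁ e * l₁ = d₁ * e := Nat.gcd_mul_lcm _ _
  have e2 : e * l₂ = d₂ * d₃ := Nat.gcd_mul_lcm _ _
  have hprod : d₁ * d₂ * d₃ ≤ 2 * (l₁ * l₂) := by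
    calc d₁ * d₂ * d₃ = Nat.gcd d₁ e * l₁ * l₂ := by rw [mul_assoc, ← e2, e1]; ring
      _ ≤ 2 * l₁ * l₂ := by gcongr; exact Nat.le_of_dvd two_pos hg
      _ = _ := by ring
  have hq2 : q ≤ 2 * (l₁ * l₂) := (Nat.le_of_dvd (by
    have := Nat.pos_of_dvd_of_pos hd₁ hq
    have := Nat.pos_of_dvd_of_pos hd₂ hq
    have := Nat.pos_of_dvd_of_pos hd₃ hq
    positivity) hqd).trans hprod
  refine Nat.le_of_mul_le_mul_left ?_ (Nat.mul_pos hl₁0 hl₂0)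
  calc l₁ * l₂ * (q / l₂ * (q / l₁)) = (l₁ * (q / l₁)) * (l₂ * (q / l₂)) := by ring
    _ = q * q := by rw [Nat.mul_div_cancel' hl₁, Nat.mul_div_cancel' hl₂]
    _ ≤ q * (2 * (l₁ * l₂)) := by gcongr
    _ = _ := by ring

open Finset in
theorem card_zmod_mul_mul_eq_zero_le (q : ℕ) [NeZero q] :
    #{p : ZMod q × ZMod q | (1 + p.1) * (p.2 - 1) * (p.1 - p.2) = 0} ≤
      2 * q * #q.divisors ^ 3 := by
  refine le_trans ?_ (card_filter_dvd_mul_mul_le (NeZero.pos q))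
  refine card_le_card_of_injOn (fun p ↦ (p.1.val, p.2.val)) (fun p hp ↦ ?_) ?_
  · have h := (mem_filter.mp hp).2
    refine mem_filter.mpr ⟨by simp [ZMod.val_lt], ?_⟩
    rw [← ZMod.intCast_zmod_eq_zero_iff_dvd]
    push_cast
    simpa using h
  · rintro ⟨a, b⟩ - ⟨a', b'⟩ - h
    simp only [Prod.mk.injEq] at h
    exact Prod.ext (ZMod.val_injective q h.1) (ZMod.val_injective q h.2)

/-- The number of pairs of pairs in `H` with the same sum and the same sum of inverses. -/
noncomputable def unitEnergy {q : ℕ} (H : Subgroup (ZMod q)ˣ) : ℕ :=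
  Nat.card {z : (H × H) × (H × H) //
    ((z.1.1 : (ZMod q)ˣ) : ZMod q) + (z.1.2 : (ZMod q)ˣ) =
      (z.2.1 : (ZMod q)ˣ) + (z.2.2 : (ZMod q)ˣ) ∧
    (((z.1.1 : (ZMod q)ˣ)⁻¹ : (ZMod q)ˣ) : ZMod q) + ((z.1.2 : (ZMod q)ˣ)⁻¹ : (ZMod q)ˣ) =
      ((z.2.1 : (ZMod q)ˣ)⁻¹ : (ZMod q)ˣ) + ((z.2.2 : (ZMod q)ˣ)⁻¹ : (ZMod q)ˣ)}

theorem ratios_mul_eq_zero {R : Type*} [CommRing R] {a b c d A B C D : R}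
    (ha : A * a = 1) (hb : B * b = 1) (hc : C * c = 1) (hd : D * d = 1)
    (h : a + b = c + d) (h' : A + B = C + D) :
    (1 + A * b) * (A * c - 1) * (A * b - A * c) = 0 := by
  have e1 : (a + b) * (c * d) - (a * b) * (c + d) = 0 := by
    have : (a + b) * (c * d) = (A + B) * (a * b * c * d) := by
      linear_combination (-(b * c * d)) * ha - (a * c * d) * hb
    rw [this, h']
    linear_combination (a * b * d) * hc + (a * b * c) * hd
  have e2 : (1 + A * b) * (A * c - 1) * (A * b - A * c) =
      A ^ 3 * ((a + b) * (c - a) * (b - c)) := by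
    have h1 : 1 + A * b = A * (a + b) := by linear_combination -ha
    have h2 : A * c - 1 = A * (c - a) := by linear_combination ha
    rw [h1, h2]; ring
  have e3 : (a + b) * (c - a) * (b - c) = (a + b) * (c * d) - (a * b) * (c + d) := by
    linear_combination (c * (a + b) - a * b) * h
  rw [e2, e3, e1, mul_zero]

open Finset in
theorem unitEnergy_le (q : ℕ) [NeZero q] (H : Subgroup (ZMod q)ˣ) :
    unitEnergy H ≤ Nat.card H * (2 * q * #q.divisors ^ 3) := by
  classical
  refine le_trans ?_ (Nat.mul_le_mul_left _ (card_zmod_mul_mul_eq_zero_le q))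
  have hc : #{p : ZMod q × ZMod q | (1 + p.1) * (p.2 - 1) * (p.1 - p.2) = 0} =
      Nat.card {p : ZMod q × ZMod q // (1 + p.1) * (p.2 - 1) * (p.1 - p.2) = 0} := by
    rw [Nat.card_eq_fintype_card, Fintype.card_subtype]
  rw [hc, ← Nat.card_prod]
  refine Nat.card_le_card_of_injective (fun z ↦ (z.1.1.1,
    ⟨((((z.1.1.1 : (ZMod q)ˣ)⁻¹ : (ZMod q)ˣ) : ZMod q) * (z.1.1.2 : (ZMod q)ˣ),
      (((z.1.1.1 : (ZMod q)ˣ)⁻¹ : (ZMod q)ˣ) : ZMod q) * (z.1.2.1 : (ZMod q)ˣ)),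
      ratios_mul_eq_zero (Units.inv_mul _) (Units.inv_mul _) (Units.inv_mul _)
        (Units.inv_mul _) z.2.1 z.2.2⟩)) ?_
  rintro ⟨⟨⟨a, b⟩, c, d⟩, h, _⟩ ⟨⟨⟨a', b'⟩, c', d'⟩, h', _⟩ himg
  simp only [Prod.mk.injEq, Subtype.mk.injEq] at himg h h'
  obtain ⟨rfl, hb, hc⟩ := himg
  have hb' := (Units.mul_right_inj _).mp hb
  have hc' := (Units.mul_right_inj _).mp hc
  rw [hb', hc'] at h
  have hd' := add_left_cancel (h.symm.trans h')
  have eb : b = b' := Subtype.ext (Units.ext hb')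
  have ec : c = c' := Subtype.ext (Units.ext hc')
  have ed : d = d' := Subtype.ext (Units.ext hd')
  subst eb ec ed
  rfl

open Finset in
theorem sum_norm_sq_sum_stdAddChar {q : ℕ} [NeZero q] {ι : Type*} [Fintype ι]
    (f g : ι → ZMod q) :
    ∑ p : ZMod q × ZMod q, ‖∑ i, ZMod.stdAddChar (p.1 * f i + p.2 * g i)‖ ^ 2 =
      (q : ℝ) ^ 2 * Nat.card {z : ι × ι // f z.1 = f z.2 ∧ g z.1 = g z.2} := by
  classical
  have horth : ∀ b : ZMod q, ∑ x : ZMod q, ZMod.stdAddChar (x * b) =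
      if b = 0 then (q : ℂ) else 0 := fun b ↦ by
    rw [AddChar.sum_mulShift b (ZMod.isPrimitive_stdAddChar q), ZMod.card]
    push_cast; rfl
  have hterm : ∀ p : ZMod q × ZMod q,
      ((‖∑ i, ZMod.stdAddChar (p.1 * f i + p.2 * g i)‖ ^ 2 : ℝ) : ℂ) =
      ∑ z : ι × ι, ZMod.stdAddChar (p.1 * (f z.1 - f z.2)) *
        ZMod.stdAddChar (p.2 * (g z.1 - g z.2)) := by
    intro p
    push_cast
    rw [← Complex.mul_conj', map_sum, sum_mul_sum, ← univ_product_univ, sum_product]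
    refine sum_congr rfl fun i _ ↦ sum_congr rfl fun j _ ↦ ?_
    rw [← AddChar.map_neg_eq_conj, ← AddChar.map_add_eq_mul, ← AddChar.map_add_eq_mul]
    congr 1; ring
  apply Complex.ofReal_injective
  rw [Complex.ofReal_sum]
  simp_rw [hterm]
  rw [sum_comm]
  have hz : ∀ z : ι × ι, ∑ p : ZMod q × ZMod q, ZMod.stdAddChar (p.1 * (f z.1 - f z.2)) *
        ZMod.stdAddChar (p.2 * (g z.1 - g z.2)) =
      if f z.1 = f z.2 ∧ g z.1 = g z.2 then (q : ℂ) ^ 2 else 0 := by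
    intro z
    rw [← univ_product_univ, sum_product]
    dsimp only
    rw [← sum_mul_sum, horth, horth]
    simp only [sub_eq_zero]
    split_ifs <;> simp_all [sq]
  simp_rw [hz]
  rw [← sum_filter, sum_const, Nat.card_eq_fintype_card, Fintype.card_subtype, nsmul_eq_mul]
  push_cast
  ring

/-- The Kloosterman sum `∑_{h ∈ H} e((u h + v h⁻¹) / q)` over a subgroup. -/
noncomputable def subgroupKloosterman {q : ℕ} [NeZero q] (H : Subgroup (ZMod q)ˣ) [Fintype H]
    (u v : ZMod q) : ℂ :=
  ∑ h : H, ZMod.stdAddChar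
    (u * ((h : (ZMod q)ˣ) : ZMod q) + v * (((h : (ZMod q)ˣ)⁻¹ : (ZMod q)ˣ) : ZMod q))

open Finset in
theorem sum_norm_subgroupKloosterman_pow_four {q : ℕ} [NeZero q] (H : Subgroup (ZMod q)ˣ) [Fintype H] :
    ∑ p : ZMod q × ZMod q, ‖subgroupKloosterman H p.1 p.2‖ ^ 4 =
      (q : ℝ) ^ 2 * unitEnergy H := by
  rw [unitEnergy, ← sum_norm_sq_sum_stdAddChar (ι := H × H)
    (fun z ↦ ((z.1 : (ZMod q)ˣ) : ZMod q) + ((z.2 : (ZMod q)ˣ) : ZMod q))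
    (fun z ↦ (((z.1 : (ZMod q)ˣ)⁻¹ : (ZMod q)ˣ) : ZMod q) +
      (((z.2 : (ZMod q)ˣ)⁻¹ : (ZMod q)ˣ) : ZMod q))]
  refine sum_congr rfl fun p _ ↦ ?_
  rw [show (4 : ℕ) = 2 * 2 from rfl, pow_mul, ← norm_pow]
  congr 2
  rw [subgroupKloosterman, sq, sum_mul_sum, ← univ_product_univ, sum_product]
  refine sum_congr rfl fun i _ ↦ sum_congr rfl fun j _ ↦ ?_
  rw [← AddChar.map_add_eq_mul]
  congr 1; ring

theorem subgroupKloosterman_mul {q : ℕ} [NeZero q] (H : Subgroup (ZMod q)ˣ) [Fintype H] (u v : ZMod q)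
    (k : H) :
    subgroupKloosterman H (u * ((k : (ZMod q)ˣ) : ZMod q))
      (v * (((k : (ZMod q)ˣ)⁻¹ : (ZMod q)ˣ) : ZMod q)) = subgroupKloosterman H u v := by
  unfold subgroupKloosterman
  refine Fintype.sum_equiv (Equiv.mulLeft k) _ _ fun h ↦ ?_
  simp only [Equiv.coe_mulLeft, Subgroup.coe_mul, Units.val_mul, mul_inv, mul_assoc]

theorem norm_subgroupKloosterman_neg {q : ℕ} [NeZero q] (H : Subgroup (ZMod q)ˣ) [Fintype H]
    (u v : ZMod q) : ‖subgroupKloosterman H (-u) (-v)‖ = ‖subgroupKloosterman H u v‖ := by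
  rw [← Complex.norm_conj (subgroupKloosterman H u v)]
  unfold subgroupKloosterman
  rw [map_sum]
  congr 1
  refine Finset.sum_congr rfl fun h _ ↦ ?_
  rw [← AddChar.map_neg_eq_conj]
  congr 1; ring

open Finset in
theorem card_natCast_mul_eq_le {q : ℕ} [NeZero q] {m : ℕ} (hm : 0 < m) (u : ZMod q) :
    #{x : ZMod q | (m : ZMod q) * x = u} ≤ m := by
  rcases ({x : ZMod q | (m : ZMod q) * x = u} : Finset _).eq_empty_or_nonempty with h | ⟨y, hy⟩
  · rw [h]; simp
  · refine le_trans ?_ (IsAddCyclic.card_nsmul_eq_zero_le (α := ZMod q) hm)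
    refine card_le_card_of_injOn (· - y) (fun x hx ↦ ?_) fun x _ x' _ h ↦ sub_left_injective h
    have h1 := (mem_filter.mp hx).2
    have h2 := (mem_filter.mp hy).2
    exact mem_filter.mpr ⟨mem_univ _, by rw [nsmul_eq_mul, mul_sub, h1, h2, sub_self]⟩

open Finset in
theorem norm_subgroupKloosterman_pow_four_le {q : ℕ} [NeZero q] (H : Subgroup (ZMod q)ˣ) [Fintype H]
    (c : (ZMod q)ˣ) {m : ℕ} (hm : 0 < m) :
    ‖subgroupKloosterman H ((m : ZMod q) * (c : ZMod q))
      ((m : ZMod q) * ((c⁻¹ : (ZMod q)ˣ) : ZMod q))‖ ^ 4 ≤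
      m * (2 * (q : ℝ) ^ 3 * (#q.divisors : ℝ) ^ 3) := by
  classical
  set u : ZMod q := (m : ZMod q) * (c : ZMod q) with hu
  set v : ZMod q := (m : ZMod q) * ((c⁻¹ : (ZMod q)ˣ) : ZMod q)
  set φ : H → ZMod q × ZMod q := fun k ↦ (u * ((k : (ZMod q)ˣ) : ZMod q),
      v * (((k : (ZMod q)ˣ)⁻¹ : (ZMod q)ˣ) : ZMod q)) with hφ
  have hfib : ∀ p, #{k : H | φ k = p} ≤ m := by
    intro p
    refine le_trans ?_ (card_natCast_mul_eq_le hm p.1)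
    refine card_le_card_of_injOn (fun k ↦ (c : ZMod q) * ((k : (ZMod q)ˣ) : ZMod q))
      (fun k hk ↦ ?_) fun k _ k' _ h ↦ ?_
    · have h1 := congrArg Prod.fst (mem_filter.mp hk).2
      refine mem_filter.mpr ⟨mem_univ _, ?_⟩
      rw [← h1, ← mul_assoc]
    · exact Subtype.ext (Units.ext ((Units.mul_right_inj c).mp h))
  have hsum : (Nat.card H : ℝ) * ‖subgroupKloosterman H u v‖ ^ 4 ≤
      m * ((q : ℝ) ^ 2 * unitEnergy H) := by
    calc (Nat.card H : ℝ) * ‖subgroupKloosterman H u v‖ ^ 4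
        = ∑ k : H, ‖subgroupKloosterman H (φ k).1 (φ k).2‖ ^ 4 := by
          simp only [hφ, subgroupKloosterman_mul, sum_const, card_univ, nsmul_eq_mul,
            Nat.card_eq_fintype_card]
      _ = ∑ p, ∑ k with φ k = p, ‖subgroupKloosterman H (φ k).1 (φ k).2‖ ^ 4 :=
          (sum_fiberwise _ _ _).symm
      _ = ∑ p, (#{k : H | φ k = p} : ℝ) * ‖subgroupKloosterman H p.1 p.2‖ ^ 4 := by
          refine sum_congr rfl fun p _ ↦ ?_
          rw [← nsmul_eq_mul, ← sum_const]
          refine sum_congr rfl fun k hk ↦ ?_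
          rw [(mem_filter.mp hk).2]
      _ ≤ ∑ p : ZMod q × ZMod q, (m : ℝ) * ‖subgroupKloosterman H p.1 p.2‖ ^ 4 := by
          gcongr with p
          exact_mod_cast hfib p
      _ = _ := by rw [← mul_sum, sum_norm_subgroupKloosterman_pow_four]
  have hH : (0 : ℝ) < Nat.card H := by exact_mod_cast Nat.card_pos
  refine le_of_mul_le_mul_left (hsum.trans ?_) hH
  have hE : (unitEnergy H : ℝ) ≤ Nat.card H * (2 * q * (#q.divisors : ℝ) ^ 3) := by
    exact_mod_cast unitEnergy_le q H
  calc (m : ℝ) * ((q : ℝ) ^ 2 * unitEnergy H)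
      ≤ m * ((q : ℝ) ^ 2 * (Nat.card H * (2 * q * (#q.divisors : ℝ) ^ 3))) := by gcongr
    _ = _ := by ring

open Finset in
theorem norm_sum_stdAddChar_ge {q : ℕ} [NeZero q] {K : ℕ} {t : ℤ}
    (ht : 6 * (K * |(t : ℝ)|) ≤ q) :
    (K : ℝ) / 2 ≤ ‖∑ k ∈ range K, ZMod.stdAddChar ((k : ZMod q) * (t : ZMod q))‖ := by
  have hq : (0 : ℝ) < q := by exact_mod_cast NeZero.pos q
  refine le_trans ?_ (Complex.re_le_norm _)
  rw [Complex.re_sum]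
  have hterm : ∀ k ∈ range K, (1 / 2 : ℝ) ≤
      (ZMod.stdAddChar ((k : ZMod q) * (t : ZMod q))).re := by
    intro k hk
    have hkK : (k : ℝ) ≤ K := by exact_mod_cast (mem_range.mp hk).le
    have h1 : ((k : ZMod q) * (t : ZMod q)) = (((k : ℤ) * t : ℤ) : ZMod q) := by push_cast; rfl
    have h2 : (2 * Real.pi * Complex.I * (((k : ℤ) * t : ℤ) : ℂ) / q : ℂ) =
        ((2 * Real.pi * (k * t) / q : ℝ) : ℂ) * Complex.I := by push_cast; ring
    rw [h1, ZMod.stdAddChar_coe, h2, Complex.exp_ofReal_mul_I_re, ← Real.cos_abs,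
      ← Real.cos_pi_div_three]
    have h3 : |2 * Real.pi * (k * t) / q| ≤ Real.pi / 3 := by
      rw [abs_div, abs_mul, abs_mul (k : ℝ), abs_of_pos Real.two_pi_pos, abs_of_pos hq,
        Nat.abs_cast, div_le_iff₀ hq]
      have : (k : ℝ) * |(t : ℝ)| ≤ q / 6 := by
        have : (k : ℝ) * |(t : ℝ)| ≤ K * |(t : ℝ)| := by gcongr
        linarith
      calc 2 * Real.pi * (k * |(t : ℝ)|) ≤ 2 * Real.pi * (q / 6) := by gcongr
        _ = _ := by ring
    exact Real.cos_le_cos_of_nonneg_of_le_pi (abs_nonneg _) (by linarith [Real.pi_pos]) h3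
  calc (K : ℝ) / 2 = ∑ k ∈ range K, (1 / 2 : ℝ) := by simp; ring
    _ ≤ _ := sum_le_sum hterm

open Finset in
theorem sum_norm_sq_sum_range_le {q : ℕ} [NeZero q] (H : Subgroup (ZMod q)ˣ) [Fintype H]
    (c : (ZMod q)ˣ) (K : ℕ) {B : ℝ} (hB0 : 0 ≤ B)
    (hB : ∀ m : ℕ, 0 < m → m < K → ‖subgroupKloosterman H ((m : ZMod q) * (c : ZMod q))
      ((m : ZMod q) * ((c⁻¹ : (ZMod q)ˣ) : ZMod q))‖ ≤ B) :
    ∑ h : H, ‖∑ k ∈ range K, ZMod.stdAddChar ((k : ZMod q) *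
      (((c * h : (ZMod q)ˣ) : ZMod q) + (((c * h)⁻¹ : (ZMod q)ˣ) : ZMod q)))‖ ^ 2 ≤
      K * Nat.card H + K ^ 2 * B := by
  set s : H → ZMod q := fun h ↦
    ((c * h : (ZMod q)ˣ) : ZMod q) + (((c * h)⁻¹ : (ZMod q)ˣ) : ZMod q) with hs
  have hS : ∀ m : ZMod q, ∑ h : H, ZMod.stdAddChar (m * s h) =
      subgroupKloosterman H (m * (c : ZMod q)) (m * ((c⁻¹ : (ZMod q)ˣ) : ZMod q)) := by
    intro m
    refine sum_congr rfl fun h _ ↦ ?_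
    simp only [hs, mul_inv, Units.val_mul]
    congr 1; ring
  have hterm : ∀ k ∈ range K, ∀ l ∈ range K,
      ‖∑ h : H, ZMod.stdAddChar (((k : ZMod q) - (l : ZMod q)) * s h)‖ ≤
        (if k = l then (Nat.card H : ℝ) else 0) + B := by
    intro k hk l hl
    rw [mem_range] at hk hl
    rcases lt_trichotomy k l with h | rfl | h
    · rw [if_neg h.ne, zero_add, hS, ← norm_subgroupKloosterman_neg]
      have := hB (l - k) (by omega) (by omega)
      rw [Nat.cast_sub h.le] at this
      convert this using 3 <;> ring
    · simp only [sub_self, zero_mul, AddChar.map_zero_eq_one, sum_const, card_univ, if_true,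
        nsmul_eq_mul, mul_one, Complex.norm_natCast, Nat.card_eq_fintype_card]
      linarith
    · rw [if_neg h.ne', zero_add, hS]
      have := hB (k - l) (by omega) (by omega)
      rwa [Nat.cast_sub h.le] at this
  have hexp : ((∑ h : H, ‖∑ k ∈ range K, ZMod.stdAddChar ((k : ZMod q) * s h)‖ ^ 2 : ℝ) : ℂ) =
      ∑ k ∈ range K, ∑ l ∈ range K, ∑ h : H,
        ZMod.stdAddChar (((k : ZMod q) - (l : ZMod q)) * s h) := by
    push_cast
    have : ∀ h : H, (‖∑ k ∈ range K, ZMod.stdAddChar ((k : ZMod q) * s h)‖ : ℂ) ^ 2 =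
        ∑ k ∈ range K, ∑ l ∈ range K, ZMod.stdAddChar (((k : ZMod q) - (l : ZMod q)) * s h) := by
      intro h
      rw [← Complex.mul_conj', map_sum, sum_mul_sum]
      refine sum_congr rfl fun k _ ↦ sum_congr rfl fun l _ ↦ ?_
      rw [← AddChar.map_neg_eq_conj, ← AddChar.map_add_eq_mul]
      congr 1; ring
    simp_rw [this]
    rw [sum_comm]
    exact sum_congr rfl fun k _ ↦ sum_comm
  calc ∑ h : H, ‖∑ k ∈ range K, ZMod.stdAddChar ((k : ZMod q) * s h)‖ ^ 2
      = ‖((∑ h : H, ‖∑ k ∈ range K, ZMod.stdAddChar ((k : ZMod q) * s h)‖ ^ 2 : ℝ) : ℂ)‖ := by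
        rw [Complex.norm_real, Real.norm_of_nonneg (by positivity)]
    _ ≤ ∑ k ∈ range K, ∑ l ∈ range K, ((if k = l then (Nat.card H : ℝ) else 0) + B) := by
        rw [hexp]
        refine (norm_sum_le _ _).trans (sum_le_sum fun k hk ↦ (norm_sum_le _ _).trans
          (sum_le_sum fun l hl ↦ hterm k hk l hl))
    _ = K * Nat.card H + K ^ 2 * B := by
        simp only [sum_add_distrib, sum_ite_eq, sum_const, card_range, nsmul_eq_mul]
        rw [sum_congr rfl fun k hk ↦ if_pos hk]
        simp only [sum_const, card_range, nsmul_eq_mul]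
        ring

/-- Counting elements of a coset `cH` with small minimal trace: for
`|H| ≥ q^{7/8}` and `2 ≤ T ≤ q^{1/10}`,
`#{a ∈ cH : |t_a| ≤ q/T} ≪_ε T⁻¹|H| + T q^{1/2+ε} |H|^{1/4}`, where `t_a ∈ [−q/2, q/2)`
is the representative of `a + a⁻¹` mod `q`. -/
theorem stmt_15 (ε : ℝ) (hε : 0 < ε) :
    ∃ C : ℝ, 0 < C ∧ ∀ (q : ℕ), 2 ≤ q →
      ∀ (H : Subgroup (ZMod q)ˣ) (c : (ZMod q)ˣ),
        (q : ℝ) ^ ((7 : ℝ) / 8) ≤ (Nat.card H : ℝ) →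
        ∀ T : ℝ, 2 ≤ T → T ≤ (q : ℝ) ^ ((1 : ℝ) / 10) →
          (Nat.card {a : (ZMod q)ˣ | a ∈ c • (H : Set (ZMod q)ˣ) ∧
              ∃ t : ℤ, ((t : ZMod q) = (a : ZMod q) + ((a⁻¹ : (ZMod q)ˣ) : ZMod q) ∧
                -(q : ℝ) / 2 ≤ (t : ℝ) ∧ (t : ℝ) < (q : ℝ) / 2 ∧
                (|t| : ℝ) ≤ (q : ℝ) / T)} : ℝ)
            ≤ C * (T⁻¹ * (Nat.card H : ℝ) +
                T * (q : ℝ) ^ ((1 : ℝ) / 2 + ε) * (Nat.card H : ℝ) ^ ((1 : ℝ) / 4)) := by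
  obtain ⟨A, hA1, hA⟩ := exists_card_divisors_le_rpow (1 / 40) (by norm_num)
  refine ⟨48 + 8 * A ^ 3, by positivity, fun q hq H c hH T hT hTq ↦ ?_⟩
  classical
  have : NeZero q := ⟨by omega⟩
  have hq1 : (1 : ℝ) ≤ q := by exact_mod_cast (by omega : 1 ≤ q)
  have hq0 : (0 : ℝ) < q := by linarith
  have hT0 : 0 < T := by linarith
  set h : ℝ := (Nat.card H : ℝ) with hh
  have hh0 : 0 < h := lt_of_lt_of_le (by positivity) hH
  set X : ℝ := T⁻¹ * h with hX
  set Y : ℝ := T * (q : ℝ) ^ ((1 : ℝ) / 2 + ε) * h ^ ((1 : ℝ) / 4) with hY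
  have hX0 : 0 < X := by positivity
  have hY0 : 0 < Y := by positivity
  have hA0 : 0 < A := by linarith
  set K : ℕ := ⌊T / 6⌋₊ with hK
  have hKT : (K : ℝ) ≤ T / 6 := Nat.floor_le (by positivity)
  set B : ℝ := 2 * A ^ 3 * (X + Y) with hB
  have hB0 : 0 ≤ B := by positivity
  have hXY : (q : ℝ) ^ ((51 : ℝ) / 16) ≤ (X + Y) ^ 4 := by
    have h1 : (q : ℝ) ^ ((1 : ℝ) / 2) * h ^ ((5 : ℝ) / 4) ≤ X * Y := by
      have e1 : h ^ ((5 : ℝ) / 4) = h * h ^ ((1 : ℝ) / 4) := by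
        rw [show (5 : ℝ) / 4 = 1 + 1 / 4 by norm_num, Real.rpow_add hh0, Real.rpow_one]
      have e2 : X * Y = (q : ℝ) ^ ((1 : ℝ) / 2 + ε) * (h * h ^ ((1 : ℝ) / 4)) := by
        rw [hX, hY]; field_simp
      rw [e1, e2]
      gcongr ?_ * _
      exact Real.rpow_le_rpow_of_exponent_le hq1 (by linarith)
    have h2 : ((q : ℝ) ^ ((7 : ℝ) / 8)) ^ ((5 : ℝ) / 4) ≤ h ^ ((5 : ℝ) / 4) := by gcongr
    have h3 : (q : ℝ) ^ ((51 : ℝ) / 32) ≤ X * Y := by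
      calc (q : ℝ) ^ ((51 : ℝ) / 32)
          = (q : ℝ) ^ ((1 : ℝ) / 2) * ((q : ℝ) ^ ((7 : ℝ) / 8)) ^ ((5 : ℝ) / 4) := by
            rw [← Real.rpow_mul hq0.le, ← Real.rpow_add hq0]; norm_num
        _ ≤ (q : ℝ) ^ ((1 : ℝ) / 2) * h ^ ((5 : ℝ) / 4) := by gcongr
        _ ≤ _ := h1
    calc (q : ℝ) ^ ((51 : ℝ) / 16) = ((q : ℝ) ^ ((51 : ℝ) / 32)) ^ 2 := by
          rw [← Real.rpow_natCast, ← Real.rpow_mul hq0.le]; norm_num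
      _ ≤ (X * Y) ^ 2 := by gcongr
      _ ≤ ((X + Y) ^ 2) ^ 2 := by
          gcongr
          nlinarith [mul_pos hX0 hY0]
      _ = _ := by ring
  have hKloos : ∀ m : ℕ, 0 < m → m < K →
      ‖subgroupKloosterman H ((m : ZMod q) * (c : ZMod q))
        ((m : ZMod q) * ((c⁻¹ : (ZMod q)ˣ) : ZMod q))‖ ≤ B := by
    intro m hm hmK
    refine le_of_pow_le_pow_left₀ four_ne_zero hB0
      ((norm_subgroupKloosterman_pow_four_le H c hm).trans ?_)
    have hmq : (m : ℝ) ≤ (q : ℝ) ^ ((1 : ℝ) / 10) := by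
      have : (m : ℝ) ≤ K := by exact_mod_cast hmK.le
      linarith
    have h2A : 1 ≤ 2 * A ^ 3 := by linarith [one_le_pow₀ hA1 (n := 3)]
    calc (m : ℝ) * (2 * (q : ℝ) ^ 3 * (q.divisors.card : ℝ) ^ 3)
        ≤ (q : ℝ) ^ ((1 : ℝ) / 10) *
            (2 * (q : ℝ) ^ 3 * (A * (q : ℝ) ^ ((1 : ℝ) / 40)) ^ 3) := by
          gcongr
          exact hA q (by omega)
      _ = 2 * A ^ 3 * (q : ℝ) ^ ((127 : ℝ) / 40) := by
          have e1 : (q : ℝ) ^ ((127 : ℝ) / 40) = (q : ℝ) ^ ((1 : ℝ) / 10) * (q : ℝ) ^ 3 *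
              ((q : ℝ) ^ ((1 : ℝ) / 40)) ^ 3 := by
            rw [← Real.rpow_natCast, ← Real.rpow_natCast, ← Real.rpow_mul hq0.le,
              ← Real.rpow_add hq0, ← Real.rpow_add hq0]
            norm_num
          rw [e1]; ring
      _ ≤ 2 * A ^ 3 * (q : ℝ) ^ ((51 : ℝ) / 16) := by
          gcongr _ * ?_
          exact Real.rpow_le_rpow_of_exponent_le hq1 (by norm_num)
      _ ≤ (2 * A ^ 3) ^ 4 * (X + Y) ^ 4 := by
          gcongr
          exact le_self_pow₀ h2A four_ne_zero
      _ = B ^ 4 := by rw [hB]; ring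
  set S : H → ℂ := fun x ↦ ∑ k ∈ Finset.range K, ZMod.stdAddChar ((k : ZMod q) *
      (((c * x : (ZMod q)ˣ) : ZMod q) + (((c * x)⁻¹ : (ZMod q)ˣ) : ZMod q))) with hS
  set F : Finset H := {x | (K : ℝ) / 2 ≤ ‖S x‖} with hF
  have hcard : Nat.card {a : (ZMod q)ˣ | a ∈ c • (H : Set (ZMod q)ˣ) ∧
      ∃ t : ℤ, ((t : ZMod q) = (a : ZMod q) + ((a⁻¹ : (ZMod q)ˣ) : ZMod q) ∧
        -(q : ℝ) / 2 ≤ (t : ℝ) ∧ (t : ℝ) < (q : ℝ) / 2 ∧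
        (|t| : ℝ) ≤ (q : ℝ) / T)} ≤ F.card := by
    rw [Nat.card_coe_set_eq]
    refine le_trans ?_ (Finset.card_image_le (f := fun x : H ↦ c * (x : (ZMod q)ˣ)))
    rw [← Set.ncard_coe_finset]
    refine Set.ncard_le_ncard ?_ (Finset.finite_toSet _)
    rintro a ⟨ha, t, ht, -, -, htT⟩
    obtain ⟨x, hx, rfl⟩ := Set.mem_smul_set.mp ha
    rw [Finset.mem_coe, Finset.mem_image]
    refine ⟨⟨x, hx⟩, ?_, rfl⟩
    rw [hF, Finset.mem_filter]
    refine ⟨Finset.mem_univ _, ?_⟩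
    simp only [hS]
    rw [smul_eq_mul] at ht
    rw [← ht]
    refine norm_sum_stdAddChar_ge ?_
    calc 6 * (K * |(t : ℝ)|) ≤ 6 * (T / 6 * (q / T)) := by gcongr
      _ = q := by field_simp
  have hcard' : (Nat.card {a : (ZMod q)ˣ | a ∈ c • (H : Set (ZMod q)ˣ) ∧
      ∃ t : ℤ, ((t : ZMod q) = (a : ZMod q) + ((a⁻¹ : (ZMod q)ˣ) : ZMod q) ∧
        -(q : ℝ) / 2 ≤ (t : ℝ) ∧ (t : ℝ) < (q : ℝ) / 2 ∧
        (|t| : ℝ) ≤ (q : ℝ) / T)} : ℝ) ≤ F.card := by exact_mod_cast hcard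
  refine hcard'.trans ?_
  have hA3 : 0 < A ^ 3 := by positivity
  rcases lt_or_ge T 6 with hT6 | hT6
  · have h1 : (F.card : ℝ) ≤ h := by
      rw [hh, Nat.card_eq_fintype_card]
      exact_mod_cast Finset.card_le_univ F
    have h2 : h ≤ 6 * X := by
      have : h = T * X := by rw [hX]; field_simp
      rw [this]; gcongr
    nlinarith [mul_pos hA3 (add_pos hX0 hY0)]
  · have hK1 : T / 12 ≤ K := by
      have h1 : T / 6 < K + 1 := Nat.lt_floor_add_one _
      have h2 : (1 : ℝ) ≤ K := by
        exact_mod_cast Nat.le_floor (by push_cast; linarith : ((1 : ℕ) : ℝ) ≤ T / 6)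
      linarith
    have hK0 : (0 : ℝ) < K := lt_of_lt_of_le (by positivity) hK1
    have h1 : (F.card : ℝ) * ((K : ℝ) / 2) ^ 2 ≤ K * h + K ^ 2 * B := by
      refine le_trans ?_ (sum_norm_sq_sum_range_le H c K hB0 hKloos)
      calc (F.card : ℝ) * ((K : ℝ) / 2) ^ 2 = ∑ x ∈ F, ((K : ℝ) / 2) ^ 2 := by
            rw [Finset.sum_const, nsmul_eq_mul]
        _ ≤ ∑ x ∈ F, ‖S x‖ ^ 2 := by
            refine Finset.sum_le_sum fun x hx ↦ ?_
            have := (Finset.mem_filter.mp hx).2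
            gcongr
        _ ≤ ∑ x, ‖S x‖ ^ 2 :=
            Finset.sum_le_univ_sum_of_nonneg fun x ↦ by positivity
    have h2 : h ≤ 12 * K * X := by
      have : h = T * X := by rw [hX]; field_simp
      rw [this]; gcongr; linarith
    have h3 : (F.card : ℝ) * ((K : ℝ) / 2) ^ 2 ≤ (48 * X + 4 * B) * ((K : ℝ) / 2) ^ 2 := by
      have : K * h ≤ K * (12 * K * X) := by gcongr
      refine h1.trans ?_
      nlinarith
    have h4 : (F.card : ℝ) ≤ 48 * X + 4 * B := le_of_mul_le_mul_right h3 (by positivity)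
    rw [hB] at h4
    have e : (48 + 8 * A ^ 3) * (X + Y) = 48 * X + 48 * Y + 4 * (2 * A ^ 3 * (X + Y)) := by ring
    rw [e]
    linarith
end

section
/- Let q ≥ 2 and H ≤ (ℤ/qℤ)^× with cH a coset. Then for every ε > 0, Σ_{0 < a < q, (a mod q) ∈ cH} a/q = |H|/2 + O_ε(|H|^{2/3} q^{1/6+ε}). -/
open Pointwise

theorem exists_card_divisors_le_rpow_s16 (ε : ℝ) (hε : 0 < ε) :
    ∃ C : ℝ, 0 < C ∧ ∀ n : ℕ, n ≠ 0 → (n.divisors.card : ℝ) ≤ C * (n : ℝ) ^ ε := by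
  obtain ⟨P, hP⟩ := exists_nat_ge ((2 : ℝ) ^ (1 / ε))
  have hL : 0 < ε * Real.log 2 := mul_pos hε (Real.log_pos one_lt_two)
  set δ : ℝ := min 1 (ε * Real.log 2)
  have hδ : 0 < δ := lt_min one_pos hL
  have hK : 1 ≤ δ⁻¹ := (one_le_inv₀ hδ).2 (min_le_left _ _)
  refine ⟨δ⁻¹ ^ P, by positivity, fun n hn => ?_⟩
  have hfac : ∀ p ∈ n.primeFactors, ((n.factorization p + 1 : ℕ) : ℝ) ≤
      (if p < P then δ⁻¹ else 1) * ((p : ℝ) ^ n.factorization p) ^ ε := by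
    intro p hp
    have hp2 : (2 : ℝ) ≤ p := by exact_mod_cast (Nat.prime_of_mem_primeFactors hp).two_le
    set k := n.factorization p
    rw [← Real.rpow_natCast, ← Real.rpow_mul (by linarith), mul_comm (k : ℝ),
      Real.rpow_mul (by linarith), Real.rpow_natCast]
    split_ifs with h
    · have h1 : δ * (k + 1) ≤ ((2 : ℝ) ^ ε) ^ k := by
        rw [Real.rpow_def_of_pos two_pos, ← Real.exp_nat_mul]
        refine le_trans ?_ (Real.add_one_le_exp _)
        have h2 : δ ≤ 1 := min_le_left _ _
        have h3 : δ ≤ ε * Real.log 2 := min_le_right _ _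
        have := mul_le_mul_of_nonneg_left h3 (Nat.cast_nonneg (α := ℝ) k)
        linarith
      rw [inv_mul_eq_div, le_div_iff₀ hδ]
      push_cast
      calc _ = δ * (k + 1) := by ring
        _ ≤ _ := h1
        _ ≤ _ := by gcongr
    · have h2 : (2 : ℝ) ≤ (p : ℝ) ^ ε := by
        have hPp : (P : ℝ) ≤ p := by exact_mod_cast not_lt.1 h
        calc (2 : ℝ) = ((2 : ℝ) ^ (1 / ε)) ^ ε := by
              rw [← Real.rpow_mul two_pos.le, one_div_mul_cancel hε.ne', Real.rpow_one]
          _ ≤ _ := Real.rpow_le_rpow (by positivity) (hP.trans hPp) hε.le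
      rw [one_mul]
      calc ((k + 1 : ℕ) : ℝ) ≤ (2 : ℝ) ^ k := by exact_mod_cast Nat.lt_two_pow_self
        _ ≤ _ := by gcongr
  have hn' : (n : ℝ) ^ ε = ∏ p ∈ n.primeFactors, ((p : ℝ) ^ n.factorization p) ^ ε := by
    rw [Real.finsetProd_rpow _ _ (fun i _ => by positivity)]
    congr 1
    conv_lhs => rw [← Nat.prod_factorization_pow_eq_self hn]
    rw [Finsupp.prod, Nat.support_factorization]
    push_cast
    rfl
  rw [Nat.card_divisors hn, hn', Nat.cast_prod]
  refine (Finset.prod_le_prod (fun _ _ => Nat.cast_nonneg _) hfac).trans ?_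
  rw [Finset.prod_mul_distrib]
  gcongr
  rw [← Finset.prod_filter, Finset.prod_const]
  refine pow_le_pow_right₀ hK ?_
  refine (Finset.card_le_card (t := Finset.range P) fun p hp => ?_).trans (Finset.card_range P).le
  exact Finset.mem_range.2 (Finset.mem_filter.1 hp).2

theorem sum_sqrt_gcd_div_le (q : ℕ) (hq : q ≠ 0) :
    ∑ m ∈ Finset.Ioo 0 q, √(m.gcd q : ℝ) / m ≤ q.divisors.card * (1 + Real.log q) := by
  have hlog : 0 ≤ Real.log q := Real.log_natCast_nonneg q
  have hd : ∀ d ∈ q.divisors, ∑ m ∈ Finset.Ioo 0 q with d ∣ m, √(d : ℝ) / m ≤ 1 + Real.log q := by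
    intro d hd
    have hd0 : 0 < d := Nat.pos_of_mem_divisors hd
    have hd1 : (1 : ℝ) ≤ d := by exact_mod_cast hd0
    have : ∑ m ∈ Finset.Ioo 0 q with d ∣ m, √(d : ℝ) / m ≤ ∑ j ∈ Finset.Icc 1 q, (j : ℝ)⁻¹ := by
      calc _ ≤ ∑ m ∈ Finset.Ioo 0 q with d ∣ m, ((m / d : ℕ) : ℝ)⁻¹ := by
            refine Finset.sum_le_sum fun m hm => ?_
            simp only [Finset.mem_filter, Finset.mem_Ioo] at hm
            obtain ⟨⟨hm0, -⟩, j, rfl⟩ := hm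
            have hj : 0 < j := Nat.pos_of_mul_pos_left hm0
            have hj' : (0 : ℝ) < j := by exact_mod_cast hj
            rw [Nat.mul_div_cancel_left _ hd0, Nat.cast_mul, div_le_iff₀ (by positivity),
              mul_comm (d : ℝ), inv_mul_cancel_left₀ hj'.ne']
            exact Real.sqrt_le_iff.2 ⟨by positivity, by nlinarith⟩
        _ = ∑ j ∈ (Finset.filter (d ∣ ·) (Finset.Ioo 0 q)).image (· / d), (j : ℝ)⁻¹ := by
            rw [Finset.sum_image]
            intro a ha b hb hab
            simp only [Finset.coe_filter, Set.mem_ofPred_eq] at ha hb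
            rw [← Nat.mul_div_cancel' ha.2, ← Nat.mul_div_cancel' hb.2]
            exact congrArg (d * ·) hab
        _ ≤ _ := by
            refine Finset.sum_le_sum_of_subset_of_nonneg (fun j hj => ?_) (fun _ _ _ => by positivity)
            simp only [Finset.mem_image, Finset.mem_filter, Finset.mem_Ioo] at hj
            obtain ⟨m, ⟨⟨hm0, hmq⟩, hdm⟩, rfl⟩ := hj
            exact Finset.mem_Icc.2 ⟨Nat.div_pos (Nat.le_of_dvd hm0 hdm) hd0,
              (Nat.div_le_self _ _).trans hmq.le⟩
    refine this.trans ?_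
    have := harmonic_le_one_add_log q
    rw [harmonic_eq_sum_Icc] at this
    push_cast at this
    exact this
  calc _ ≤ ∑ m ∈ Finset.Ioo 0 q, ∑ d ∈ q.divisors with d ∣ m, √(d : ℝ) / m := by
        refine Finset.sum_le_sum fun m _ => ?_
        refine Finset.single_le_sum (f := fun d : ℕ => √(d : ℝ) / m) (fun _ _ => by positivity) ?_
        simp [Nat.gcd_dvd_left, Nat.gcd_dvd_right, hq]
    _ = ∑ d ∈ q.divisors, ∑ m ∈ Finset.Ioo 0 q with d ∣ m, √(d : ℝ) / m := by
        simp_rw [Finset.sum_filter]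
        exact Finset.sum_comm
    _ ≤ _ := by
        simpa only [nsmul_eq_mul] using Finset.sum_le_card_nsmul _ _ _ hd

section ZMod

open ZMod

theorem card_mul_eq_le_gcd {q : ℕ} [NeZero q] (x y : ZMod q) :
    (Finset.univ.filter fun z : ZMod q => x * z = y).card ≤ x.val.gcd q := by
  rcases (Finset.univ.filter fun z : ZMod q => x * z = y).eq_empty_or_nonempty with h | ⟨z₀, h₀⟩
  · simp [h]
  have hq : 0 < q := NeZero.pos q
  set d := x.val.gcd q with hd
  have hd0 : 0 < d := Nat.gcd_pos_of_pos_right _ hq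
  have hdq : d ∣ q := Nat.gcd_dvd_right _ _
  refine (Finset.card_le_card_of_injOn (t := Finset.range d)
    (fun z => (z - z₀).val / (q / d)) ?_ ?_).trans (Finset.card_range d).le
  · intro z _
    have := ZMod.val_lt (z - z₀)
    simp only [Finset.coe_range, Set.mem_Iio]
    rw [Nat.div_lt_iff_lt_mul (Nat.div_pos (Nat.le_of_dvd hq hdq) hd0), Nat.mul_div_cancel' hdq]
    exact this
  · have key : ∀ z ∈ Finset.univ.filter (fun z : ZMod q => x * z = y), q / d ∣ (z - z₀).val := by
      intro z hz
      have hx : x * (z - z₀) = 0 := by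
        rw [mul_sub, (Finset.mem_filter.1 hz).2, (Finset.mem_filter.1 h₀).2, sub_self]
      have h1 : q ∣ x.val * (z - z₀).val := by
        rw [← ZMod.natCast_eq_zero_iff]
        simpa using hx
      have h2 : q / d ∣ x.val / d * (z - z₀).val := by
        rw [← Nat.mul_dvd_mul_iff_left hd0, Nat.mul_div_cancel' hdq, ← mul_assoc,
          Nat.mul_div_cancel' (Nat.gcd_dvd_left _ _)]
        exact h1
      exact (Nat.coprime_div_gcd_div_gcd hd0).symm.dvd_of_dvd_mul_left h2
    intro a ha b hb hab
    have : (a - z₀).val = (b - z₀).val := by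
      rw [← Nat.div_mul_cancel (key a ha), ← Nat.div_mul_cancel (key b hb)]
      exact congrArg (· * (q / d)) hab
    exact sub_left_injective (ZMod.val_injective q this)

theorem sum_stdAddChar_mul {q : ℕ} [NeZero q] (t : ZMod q) :
    ∑ k : ZMod q, stdAddChar (k * t) = if t = 0 then (q : ℂ) else 0 := by
  have := AddChar.sum_mulShift t (isPrimitive_stdAddChar q)
  simpa using this

/-- The exponential sum over a finite family of residues. -/
noncomputable def expSum {q : ℕ} [NeZero q] {ι : Type*} [Fintype ι] (u : ι → ZMod q)
    (k : ZMod q) : ℂ := ∑ i, stdAddChar (k * u i)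

theorem conj_expSum {q : ℕ} [NeZero q] {ι : Type*} [Fintype ι] (u : ι → ZMod q) (k : ZMod q) :
    (starRingEnd ℂ) (expSum u k) = expSum u (-k) := by
  simp [expSum, AddChar.map_neg_eq_conj]

theorem sum_norm_sq_expSum {q : ℕ} [NeZero q] {ι : Type*} [Fintype ι] {u : ι → ZMod q}
    (hu : Function.Injective u) :
    ∑ k, ‖expSum u k‖ ^ 2 = q * Fintype.card ι := by
  classical
  have : (∑ k, (‖expSum u k‖ : ℂ) ^ 2) = q * Fintype.card ι := by
    calc (∑ k, (‖expSum u k‖ : ℂ) ^ 2)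
        = ∑ k, ∑ i, ∑ j, stdAddChar (k * (u i - u j)) := by
          refine Finset.sum_congr rfl fun k _ => ?_
          rw [← Complex.mul_conj', conj_expSum, expSum, expSum, Finset.sum_mul_sum]
          refine Finset.sum_congr rfl fun i _ => Finset.sum_congr rfl fun j _ => ?_
          rw [← AddChar.map_add_eq_mul]
          congr 1
          ring
      _ = ∑ i, ∑ j, ∑ k, stdAddChar (k * (u i - u j)) := by
          rw [Finset.sum_comm]
          exact Finset.sum_congr rfl fun i _ => Finset.sum_comm
      _ = _ := by
          simp [sum_stdAddChar_mul, sub_eq_zero, hu.eq_iff, mul_comm]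
  exact_mod_cast this

theorem norm_expSum_coset_le {q : ℕ} [NeZero q] (H : Subgroup (ZMod q)ˣ) [Fintype H]
    (c : (ZMod q)ˣ) (k : ZMod q) :
    ‖expSum (fun h : H => ((c * h : (ZMod q)ˣ) : ZMod q)) k‖ ≤ √q * √(k.val.gcd q : ℝ) := by
  set u : H → ZMod q := fun h => ((c * h : (ZMod q)ˣ) : ZMod q)
  have hu : Function.Injective u := fun a b hab =>
    Subtype.ext (mul_left_cancel (Units.ext hab))
  have hinv : ∀ h : H, expSum u (k * ((h : (ZMod q)ˣ) : ZMod q)) = expSum u k := by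
    intro h
    refine Fintype.sum_equiv (Equiv.mulLeft h) _ _ fun i => ?_
    congr 1
    simp only [u, Equiv.coe_mulLeft, Subgroup.coe_mul, Units.val_mul]
    ring
  have hcard : (0 : ℝ) < Fintype.card H := by exact_mod_cast Fintype.card_pos
  have hmain : (Fintype.card H : ℝ) * ‖expSum u k‖ ^ 2 ≤
      Fintype.card H * (q * (k.val.gcd q : ℝ)) := by
    calc (Fintype.card H : ℝ) * ‖expSum u k‖ ^ 2
        = ∑ h : H, ‖expSum u (k * ((h : (ZMod q)ˣ) : ZMod q))‖ ^ 2 := by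
          simp [hinv]
      _ = ∑ y : ZMod q, ∑ h ∈ Finset.univ.filter (fun h : H => k * ((h : (ZMod q)ˣ) : ZMod q) = y),
            ‖expSum u (k * ((h : (ZMod q)ˣ) : ZMod q))‖ ^ 2 :=
          (Finset.sum_fiberwise _ _ _).symm
      _ ≤ ∑ y : ZMod q, (k.val.gcd q : ℝ) * ‖expSum u y‖ ^ 2 := by
          refine Finset.sum_le_sum fun y _ => ?_
          rw [Finset.sum_congr rfl fun h hh => by rw [(Finset.mem_filter.1 hh).2],
            Finset.sum_const, nsmul_eq_mul]
          gcongr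
          refine le_trans ?_ (card_mul_eq_le_gcd k y)
          refine Finset.card_le_card_of_injOn (fun h : H => ((h : (ZMod q)ˣ) : ZMod q)) ?_ ?_
          · intro h hh
            simpa using hh
          · exact fun a _ b _ hab => Subtype.ext (Units.ext hab)
      _ = _ := by
          rw [← Finset.mul_sum, sum_norm_sq_expSum hu]
          ring
  rw [← Real.sqrt_mul (Nat.cast_nonneg q)]
  exact Real.le_sqrt_of_sq_le (le_of_mul_le_mul_left hmain hcard)

theorem inv_norm_stdAddChar_sub_one_le {q : ℕ} [NeZero q] {k : ZMod q} (hk : k ≠ 0) :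
    ‖stdAddChar k - 1‖⁻¹ ≤ q / 4 * ((k.val : ℝ)⁻¹ + ((-k).val : ℝ)⁻¹) := by
  have hq : (0 : ℝ) < q := by exact_mod_cast NeZero.pos q
  have : NeZero k := ⟨hk⟩
  have hm : (0 : ℝ) < k.val := by exact_mod_cast ZMod.val_pos.2 hk
  have hneg : ((-k).val : ℝ) = q - k.val := by
    rw [ZMod.val_neg_of_ne_zero, Nat.cast_sub (ZMod.val_lt k).le]
  have hlt : (k.val : ℝ) < q := by exact_mod_cast ZMod.val_lt k
  rw [hneg]
  set m : ℝ := (k.val : ℝ)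
  have hnorm : ‖stdAddChar k - 1‖ = |2 * Real.sin (Real.pi * m / q)| := by
    have : stdAddChar k = Complex.exp (Complex.I * ((2 * Real.pi * m / q : ℝ) : ℂ)) := by
      conv_lhs => rw [← ZMod.natCast_zmod_val k]
      have := stdAddChar_coe (N := q) (k.val : ℤ)
      push_cast at this
      rw [this]
      congr 1
      simp only [m]
      push_cast
      ring
    rw [this, Complex.norm_exp_I_mul_ofReal_sub_one, Real.norm_eq_abs]
    congr 3
    ring
  rw [hnorm]
  have hx : ∀ t : ℝ, 0 < t → t ≤ q / 2 → Real.sin (Real.pi * t / q) = Real.sin (Real.pi * m / q) →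
      |2 * Real.sin (Real.pi * m / q)|⁻¹ ≤ q / 4 * t⁻¹ := by
    intro t ht htq hs
    rw [← hs]
    have h1 : 2 / Real.pi * (Real.pi * t / q) ≤ Real.sin (Real.pi * t / q) := by
      refine Real.mul_le_sin (by positivity) ?_
      rw [div_le_iff₀ hq]
      nlinarith [Real.pi_pos]
    have h2 : 2 / Real.pi * (Real.pi * t / q) = 2 * t / q := by
      field_simp
    rw [h2] at h1
    have h3 : 0 < 2 * t / q := by positivity
    have h4 : 4 * t / q ≤ |2 * Real.sin (Real.pi * t / q)| := by
      refine le_trans ?_ (le_abs_self _)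
      calc 4 * t / q = 2 * (2 * t / q) := by ring
        _ ≤ _ := by gcongr
    calc _ ≤ (4 * t / q)⁻¹ := inv_anti₀ (by positivity) h4
      _ = _ := by field_simp
  rcases le_total m (q / 2) with h | h
  · refine (hx m hm h rfl).trans ?_
    have : 0 ≤ (q - m)⁻¹ := inv_nonneg.2 (by linarith)
    gcongr
    linarith
  · refine (hx (q - m) (by linarith) (by linarith) ?_).trans ?_
    · rw [← Real.sin_pi_sub]
      congr 1
      field_simp
      ring
    · have : 0 ≤ m⁻¹ := by positivity
      gcongr
      linarith

theorem val_add_one_eq {q : ℕ} [NeZero q] (a : ZMod q) :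
    ((a + 1).val : ℂ) = a.val + 1 - if a = -1 then (q : ℂ) else 0 := by
  have hq := NeZero.pos q
  have hlt := ZMod.val_lt a
  have h : (a + 1 : ZMod q) = ((a.val + 1 : ℕ) : ZMod q) := by simp
  split_ifs with ha
  · have h0 : ((a.val + 1 : ℕ) : ZMod q) = 0 := by rw [← h, ha]; simp
    have h1 : a.val + 1 = q :=
      le_antisymm hlt (Nat.le_of_dvd (Nat.succ_pos _) ((ZMod.natCast_eq_zero_iff _ _).1 h0))
    rw [h, h0, ZMod.val_zero, Nat.cast_zero]
    have h2 : (a.val : ℂ) + 1 = q := by exact_mod_cast h1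
    rw [h2, sub_self]
  · have hne : a.val + 1 ≠ q := by
      intro h1
      apply ha
      rw [h1, ZMod.natCast_self] at h
      exact eq_neg_of_add_eq_zero_left h
    rw [h, ZMod.val_natCast_of_lt (by omega)]
    simp

theorem dft_val_mul {q : ℕ} [NeZero q] {k : ZMod q} (hk : k ≠ 0) :
    dft (fun a : ZMod q => (a.val : ℂ)) k * (stdAddChar (-k) - 1) = q := by
  set F := dft (fun a : ZMod q => (a.val : ℂ)) k with hF
  have h1 : F = ∑ a : ZMod q, stdAddChar (-((a + 1) * k)) * ((a + 1).val : ℂ) := by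
    rw [hF, dft_apply]
    simp only [smul_eq_mul]
    exact (Equiv.sum_comp (Equiv.addRight (1 : ZMod q))
      (fun a : ZMod q => stdAddChar (-(a * k)) * (a.val : ℂ))).symm
  have hz : ∑ a : ZMod q, stdAddChar (-((a + 1) * k)) = 0 := by
    refine (Equiv.sum_comp (Equiv.addRight (1 : ZMod q))
      (fun a : ZMod q => stdAddChar (-(a * k)))).trans ?_
    have := sum_stdAddChar_mul (-k)
    simpa [hk] using this
  have h2 : F = stdAddChar (-k) * F - q := by
    conv_lhs => rw [h1]
    simp_rw [val_add_one_eq, mul_sub, mul_add, Finset.sum_sub_distrib, Finset.sum_add_distrib,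
      mul_one, hz]
    have e1 : ∑ a : ZMod q, stdAddChar (-((a + 1) * k)) * (a.val : ℂ) = stdAddChar (-k) * F := by
      rw [hF, dft_apply, Finset.mul_sum]
      refine Finset.sum_congr rfl fun a _ => ?_
      rw [smul_eq_mul, ← mul_assoc, ← AddChar.map_add_eq_mul]
      congr 2
      ring
    rw [e1]
    simp
  linear_combination -h2

theorem dft_val_zero {q : ℕ} [NeZero q] :
    dft (fun a : ZMod q => (a.val : ℂ)) 0 = q * (q - 1) / 2 := by
  rw [dft_apply_zero]
  have h1 : ∑ j : ZMod q, j.val = ∑ j ∈ Finset.range q, j := by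
    refine Finset.sum_nbij ZMod.val (fun a _ => Finset.mem_range.2 (ZMod.val_lt a))
      (fun a _ b _ h => ZMod.val_injective q h) (fun j hj => ?_) (fun _ _ => rfl)
    exact ⟨(j : ZMod q), by simp, ZMod.val_natCast_of_lt (by simpa using hj)⟩
  have h2 := Finset.sum_range_id_mul_two q
  rw [← h1] at h2
  have h3 : ((∑ j : ZMod q, j.val : ℕ) : ℂ) * 2 = q * (q - 1) := by
    rw [← Nat.cast_pred (NeZero.pos q)]
    exact_mod_cast h2
  rw [← h3]
  push_cast
  ring

theorem abs_sum_val_div_sub_le {q : ℕ} [NeZero q] {ι : Type*} [Fintype ι] (u : ι → ZMod q) :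
    |∑ i, ((u i).val : ℝ) / q - (Fintype.card ι : ℝ) / 2| ≤
      Fintype.card ι / (2 * q) + 1 / 2 * ∑ m ∈ Finset.Ioo 0 q, ‖expSum u (m : ZMod q)‖ / m := by
  classical
  have hq : (0 : ℝ) < q := by exact_mod_cast NeZero.pos q
  have hqc : (q : ℂ) ≠ 0 := by exact_mod_cast NeZero.ne q
  set F := dft (fun a : ZMod q => (a.val : ℂ)) with hF
  set R : ℂ := ∑ k ∈ Finset.univ.erase (0 : ZMod q), F k * expSum u k with hR
  have hinv : ∀ a : ZMod q, (a.val : ℂ) = (q : ℂ)⁻¹ * ∑ k, stdAddChar (k * a) * F k := by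
    intro a
    have := congrFun (LinearEquiv.symm_apply_apply (dft (N := q) (E := ℂ)) (fun a => (a.val : ℂ))) a
    rw [invDFT_apply] at this
    exact this.symm
  have hsum : ∑ i, ((u i).val : ℂ) = (q : ℂ)⁻¹ * (F 0 * Fintype.card ι + R) := by
    have h0 : expSum u 0 = Fintype.card ι := by simp [expSum]
    rw [← h0, hR, Finset.add_sum_erase _ (fun k => F k * expSum u k) (Finset.mem_univ 0)]
    simp_rw [hinv, ← Finset.mul_sum, expSum, Finset.mul_sum]
    rw [Finset.sum_comm]
    refine Finset.sum_congr rfl fun _ _ => Finset.sum_congr rfl fun _ _ => ?_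
    ring
  have hid : ((∑ i, ((u i).val : ℝ) / q - (Fintype.card ι : ℝ) / 2 : ℝ) : ℂ) =
      -(Fintype.card ι / (2 * q)) + R / q ^ 2 := by
    push_cast
    rw [← Finset.sum_div, hsum, hF, dft_val_zero]
    field_simp
    ring
  have hRle : ‖R‖ ≤ q ^ 2 * (1 / 2 * ∑ m ∈ Finset.Ioo 0 q, ‖expSum u (m : ZMod q)‖ / m) := by
    have hterm : ∀ k ∈ Finset.univ.erase (0 : ZMod q), ‖F k * expSum u k‖ ≤
        q ^ 2 / 4 * (‖expSum u k‖ / k.val + ‖expSum u (-k)‖ / (-k).val) := by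
      intro k hk
      have hk0 : k ≠ 0 := Finset.ne_of_mem_erase hk
      have h1 : ‖F k‖ = q * ‖stdAddChar (-k) - 1‖⁻¹ := by
        have h2 := congrArg norm (dft_val_mul hk0)
        rw [norm_mul, Complex.norm_natCast] at h2
        have h3 : ‖stdAddChar (-k) - 1‖ ≠ 0 := by
          intro h
          rw [h, mul_zero] at h2
          exact hq.ne h2
        rw [← h2, mul_inv_cancel_right₀ h3]
      have h4 := inv_norm_stdAddChar_sub_one_le (neg_ne_zero.2 hk0)
      rw [neg_neg] at h4
      have h5 : ‖expSum u (-k)‖ = ‖expSum u k‖ := by rw [← conj_expSum, RCLike.norm_conj]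
      rw [norm_mul, h1, h5]
      calc _ ≤ q * (q / 4 * (((-k).val : ℝ)⁻¹ + (k.val : ℝ)⁻¹)) * ‖expSum u k‖ := by gcongr
        _ = _ := by ring
    refine (norm_sum_le_of_le _ hterm).trans ?_
    rw [← Finset.mul_sum, Finset.sum_add_distrib]
    have hneg : ∑ k ∈ Finset.univ.erase (0 : ZMod q), ‖expSum u (-k)‖ / (-k).val =
        ∑ k ∈ Finset.univ.erase (0 : ZMod q), ‖expSum u k‖ / k.val :=
      Finset.sum_nbij' (fun k => -k) (fun k => -k) (by simp) (by simp) (by simp) (by simp)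
        (by simp)
    have hval : ∑ k ∈ Finset.univ.erase (0 : ZMod q), ‖expSum u k‖ / k.val =
        ∑ m ∈ Finset.Ioo 0 q, ‖expSum u (m : ZMod q)‖ / m := by
      refine Finset.sum_nbij' ZMod.val (fun m => (m : ZMod q)) ?_ ?_ (by simp) ?_ (by simp)
      · intro k hk
        exact Finset.mem_Ioo.2 ⟨ZMod.val_pos.2 (Finset.ne_of_mem_erase hk), ZMod.val_lt k⟩
      · intro m hm
        rw [Finset.mem_Ioo] at hm
        simp only [Finset.mem_erase, Finset.mem_univ, and_true, Ne, ZMod.natCast_eq_zero_iff]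
        exact Nat.not_dvd_of_pos_of_lt hm.1 hm.2
      · intro m hm
        exact ZMod.val_natCast_of_lt (Finset.mem_Ioo.1 hm).2
    rw [hneg, hval]
    exact le_of_eq (by ring)
  rw [← Real.norm_eq_abs, ← Complex.norm_real, hid]
  refine (norm_add_le _ _).trans ?_
  gcongr
  · rw [norm_neg]
    simp
  · rw [norm_div, norm_pow, Complex.norm_natCast, div_le_iff₀ (by positivity), mul_comm]
    exact hRle

theorem sum_indicator_coset_eq {q : ℕ} (hq : 2 ≤ q) [NeZero q] (H : Subgroup (ZMod q)ˣ)
    [Fintype H] (c : (ZMod q)ˣ) :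
    (∑ a ∈ Finset.Ioo 0 q,
        Set.indicator
          {b : ℕ | ∃ u : (ZMod q)ˣ, u ∈ c • (H : Set (ZMod q)ˣ) ∧
            ((u : (ZMod q)ˣ) : ZMod q) = (b : ZMod q)}
          (fun b => (b : ℝ) / (q : ℝ)) a) =
      ∑ h : H, (((c * h : (ZMod q)ˣ) : ZMod q).val : ℝ) / q := by
  have : Fact (1 < q) := ⟨hq⟩
  symm
  refine Finset.sum_of_injOn (fun h : H => ((c * h : (ZMod q)ˣ) : ZMod q).val) ?_ ?_ ?_ ?_
  · exact fun a _ b _ hab => Subtype.ext (mul_left_cancel (Units.ext (ZMod.val_injective q hab)))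
  · intro h _
    exact Finset.mem_coe.2 (Finset.mem_Ioo.2 ⟨ZMod.val_pos.2 (Units.ne_zero _), ZMod.val_lt _⟩)
  · intro a ha hna
    refine Set.indicator_of_notMem ?_ _
    rintro ⟨u, ⟨h, hh, rfl⟩, hu⟩
    refine hna ⟨⟨h, hh⟩, by simp, ?_⟩
    simp only [smul_eq_mul] at hu
    simp only [hu]
    exact ZMod.val_natCast_of_lt (Finset.mem_Ioo.1 ha).2
  · intro h _
    rw [Set.indicator_of_mem]
    exact ⟨c * h, ⟨h, h.2, rfl⟩, by simp⟩

theorem abs_sum_coset_sub_le {q : ℕ} [NeZero q] (H : Subgroup (ZMod q)ˣ) [Fintype H]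
    (c : (ZMod q)ˣ) :
    |∑ h : H, (((c * h : (ZMod q)ˣ) : ZMod q).val : ℝ) / q - (Fintype.card H : ℝ) / 2| ≤
      √q * (q.divisors.card * (1 + Real.log q)) := by
  have hq1 : 1 ≤ q := NeZero.pos q
  have hq : (1 : ℝ) ≤ q := by exact_mod_cast hq1
  have hcard : (Fintype.card H : ℝ) ≤ q := by
    have h1 : Fintype.card H ≤ Fintype.card (ZMod q) :=
      Fintype.card_le_of_injective (fun h : H => ((h : (ZMod q)ˣ) : ZMod q))
        fun a b hab => Subtype.ext (Units.ext hab)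
    rw [ZMod.card] at h1
    exact_mod_cast h1
  refine (abs_sum_val_div_sub_le fun h : H => ((c * h : (ZMod q)ˣ) : ZMod q)).trans ?_
  have h2 : ∑ m ∈ Finset.Ioo 0 q,
      ‖expSum (fun h : H => ((c * h : (ZMod q)ˣ) : ZMod q)) (m : ZMod q)‖ / m ≤
      √q * (q.divisors.card * (1 + Real.log q)) := by
    calc _ ≤ ∑ m ∈ Finset.Ioo 0 q, √q * (√(m.gcd q : ℝ) / m) := by
          refine Finset.sum_le_sum fun m hm => ?_
          have := norm_expSum_coset_le H c (m : ZMod q)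
          rw [ZMod.val_natCast_of_lt (Finset.mem_Ioo.1 hm).2] at this
          rw [← mul_div_assoc]
          gcongr
      _ ≤ _ := by
          rw [← Finset.mul_sum]
          gcongr
          exact sum_sqrt_gcd_div_le q (NeZero.ne q)
  have h3 : (Fintype.card H : ℝ) / (2 * q) ≤ 1 / 2 := by
    rw [div_le_iff₀ (by positivity)]
    linarith
  have h4 : 1 ≤ √q * (q.divisors.card * (1 + Real.log q)) := by
    have hs : 1 ≤ √(q : ℝ) := Real.one_le_sqrt.2 hq
    have hd : (1 : ℝ) ≤ q.divisors.card := by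
      exact_mod_cast Finset.card_pos.2 ⟨1, Nat.one_mem_divisors.2 (NeZero.ne q)⟩
    have hl : 1 ≤ 1 + Real.log q := by linarith [Real.log_nonneg hq]
    exact one_le_mul_of_one_le_of_one_le hs (one_le_mul_of_one_le_of_one_le hd hl)
  linarith

end ZMod

theorem le_rpow_interpolation {x N q B : ℝ} (hq : 1 ≤ q) (hN : 0 ≤ N) (hB : 1 ≤ B)
    (h1 : x ≤ N) (h2 : x ≤ √q * B) :
    x ≤ B * N ^ ((2 : ℝ) / 3) * q ^ ((1 : ℝ) / 6) := by
  have hq0 : 0 ≤ q := by linarith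
  rcases le_total N (√q) with h | h
  · have e1 : N = N ^ ((2 : ℝ) / 3) * N ^ ((1 : ℝ) / 3) := by
      rw [← Real.rpow_add_of_nonneg hN (by norm_num) (by norm_num)]
      norm_num
    have e2 : N ^ ((1 : ℝ) / 3) ≤ q ^ ((1 : ℝ) / 6) := by
      refine (Real.rpow_le_rpow hN h (by norm_num)).trans (le_of_eq ?_)
      rw [Real.sqrt_eq_rpow, ← Real.rpow_mul hq0]
      norm_num
    have hp : 0 ≤ N ^ ((2 : ℝ) / 3) * q ^ ((1 : ℝ) / 6) := by positivity
    calc x ≤ N ^ ((2 : ℝ) / 3) * N ^ ((1 : ℝ) / 3) := h1.trans e1.le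
      _ ≤ N ^ ((2 : ℝ) / 3) * q ^ ((1 : ℝ) / 6) := by gcongr
      _ ≤ B * (N ^ ((2 : ℝ) / 3) * q ^ ((1 : ℝ) / 6)) := le_mul_of_one_le_left hp hB
      _ = _ := by ring
  · have e1 : √q = (√q) ^ ((2 : ℝ) / 3) * q ^ ((1 : ℝ) / 6) := by
      rw [Real.sqrt_eq_rpow, ← Real.rpow_mul hq0,
        ← Real.rpow_add_of_nonneg hq0 (by norm_num) (by norm_num)]
      norm_num
    calc x ≤ √q * B := h2
      _ = B * (√q) ^ ((2 : ℝ) / 3) * q ^ ((1 : ℝ) / 6) := by rw [mul_assoc, ← e1, mul_comm]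
      _ ≤ _ := by gcongr

/-- Equidistribution of the representatives of a coset `cH` in `(0, q)`:
`Σ_{0 < a < q, a mod q ∈ cH} a/q = |H|/2 + O_ε(|H|^{2/3} q^{1/6+ε})`. -/
theorem stmt_16 (ε : ℝ) (hε : 0 < ε) :
    ∃ C : ℝ, 0 < C ∧ ∀ (q : ℕ), 2 ≤ q →
      ∀ (H : Subgroup (ZMod q)ˣ) (c : (ZMod q)ˣ),
        |(∑ a ∈ Finset.Ioo 0 q,
            Set.indicator
              {b : ℕ | ∃ u : (ZMod q)ˣ, u ∈ c • (H : Set (ZMod q)ˣ) ∧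
                ((u : (ZMod q)ˣ) : ZMod q) = (b : ZMod q)}
              (fun b => (b : ℝ) / (q : ℝ)) a) - (Nat.card H : ℝ) / 2|
          ≤ C * (Nat.card H : ℝ) ^ ((2 : ℝ) / 3) * (q : ℝ) ^ ((1 : ℝ) / 6 + ε) := by
  obtain ⟨C, hC, hdiv⟩ := exists_card_divisors_le_rpow_s16 (ε / 2) (half_pos hε)
  refine ⟨max 1 (C * (1 + 2 / ε)), by positivity, fun q hq2 H c => ?_⟩
  have : NeZero q := ⟨by omega⟩
  let _ : Fintype H := Fintype.ofFinite H
  have hq : (1 : ℝ) ≤ q := by exact_mod_cast (by omega : 1 ≤ q)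
  have hq0 : (0 : ℝ) < q := by linarith
  rw [sum_indicator_coset_eq hq2, Nat.card_eq_fintype_card]
  have hB : (q.divisors.card : ℝ) * (1 + Real.log q) ≤
      max 1 (C * (1 + 2 / ε)) * (q : ℝ) ^ ε := by
    have hpow : (1 : ℝ) ≤ (q : ℝ) ^ (ε / 2) := Real.one_le_rpow hq (half_pos hε).le
    have hlog : 1 + Real.log q ≤ (1 + 2 / ε) * (q : ℝ) ^ (ε / 2) := by
      have h := Real.log_le_rpow_div hq0.le (half_pos hε)
      have e : (q : ℝ) ^ (ε / 2) / (ε / 2) = 2 / ε * (q : ℝ) ^ (ε / 2) := by field_simp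
      linarith
    calc _ ≤ C * (q : ℝ) ^ (ε / 2) * ((1 + 2 / ε) * (q : ℝ) ^ (ε / 2)) :=
          mul_le_mul (hdiv q (NeZero.ne q)) hlog (by linarith [Real.log_nonneg hq])
            (by positivity)
      _ = C * (1 + 2 / ε) * (q : ℝ) ^ ε := by
          rw [← add_halves ε, Real.rpow_add hq0, add_halves]
          ring
      _ ≤ _ := by
          gcongr
          exact le_max_right _ _
  have htriv : |∑ h : H, (((c * h : (ZMod q)ˣ) : ZMod q).val : ℝ) / q -
      (Fintype.card H : ℝ) / 2| ≤ Fintype.card H := by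
    have h0 : 0 ≤ ∑ h : H, (((c * h : (ZMod q)ˣ) : ZMod q).val : ℝ) / q :=
      Finset.sum_nonneg fun _ _ => by positivity
    have h1 : ∑ h : H, (((c * h : (ZMod q)ˣ) : ZMod q).val : ℝ) / q ≤ Fintype.card H := by
      have : ∀ h ∈ (Finset.univ : Finset H),
          (((c * h : (ZMod q)ˣ) : ZMod q).val : ℝ) / q ≤ 1 := fun h _ =>
        div_le_one_of_le₀ (by exact_mod_cast (ZMod.val_lt _).le) hq0.le
      simpa using Finset.sum_le_card_nsmul _ _ _ this
    rw [abs_le]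
    constructor <;> linarith [Nat.cast_nonneg (α := ℝ) (Fintype.card H)]
  have hmain := le_rpow_interpolation (B := max 1 (C * (1 + 2 / ε)) * (q : ℝ) ^ ε) hq
    (Nat.cast_nonneg _)
    (one_le_mul_of_one_le_of_one_le (le_max_left _ _) (Real.one_le_rpow hq hε.le)) htriv
    ((abs_sum_coset_sub_le H c).trans (by gcongr))
  refine hmain.trans (le_of_eq ?_)
  rw [Real.rpow_add hq0]
  ring
end
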